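/- Let f : ℝ^n → ℝ be continuously differentiable with L-Lipschitz gradient, let Q be a real n×d' matrix, let ε > 0 and x ∈ ℝ^n with ∇_{Q,ε}f(x) the finite-difference subspace gradient. Assume ‖Qᵀ∇f(x)‖ ≥ 4 d' ‖Q‖_op² L ε with ε > 0 (so Q∇_{Q,ε}f(x) ≠ 0), and let P be a real n×m matrix one of whose columns equals Q∇_{Q,ε}f(x)/‖Q∇_{Q,ε}f(x)‖. Then ‖Pᵀ∇f(x)‖ ≥ (1/3) ‖Qᵀ∇f(x)‖ / ‖Q‖_op. -/

import Mathlib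

open Matrix

/-- The operator norm of a matrix acting between Euclidean spaces. -/
noncomputable def matOpNorm {n m : ℕ} (A : Matrix (Fin n) (Fin m) ℝ) : ℝ :=
  ‖LinearMap.toContinuousLinearMap (Matrix.toEuclideanLin A)‖

/-- The finite-difference subspace gradient: `(∇_{Q,ε}f(x))_i = (f(x+εQe_i) - f(x-εQe_i))/(2ε)`. -/
noncomputable def fdGrad {n d' : ℕ} (f : EuclideanSpace ℝ (Fin n) → ℝ)
    (Q : Matrix (Fin n) (Fin d') ℝ) (ε : ℝ) (x : EuclideanSpace ℝ (Fin n)) :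
    EuclideanSpace ℝ (Fin d') :=
  (EuclideanSpace.equiv (Fin d') ℝ).symm fun i =>
    (f (x + ε • Matrix.toEuclideanLin Q (EuclideanSpace.single i (1 : ℝ))) -
      f (x - ε • Matrix.toEuclideanLin Q (EuclideanSpace.single i (1 : ℝ)))) / (2 * ε)

lemma norm_toEuclideanLin_le {n m : ℕ} (A : Matrix (Fin n) (Fin m) ℝ)
    (v : EuclideanSpace ℝ (Fin m)) :
    ‖Matrix.toEuclideanLin A v‖ ≤ matOpNorm A * ‖v‖ :=
  (LinearMap.toContinuousLinearMap (Matrix.toEuclideanLin A)).le_opNorm v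

lemma inner_toEuclideanLin_transpose {n m : ℕ} (A : Matrix (Fin n) (Fin m) ℝ)
    (v : EuclideanSpace ℝ (Fin m)) (w : EuclideanSpace ℝ (Fin n)) :
    inner ℝ v (Matrix.toEuclideanLin Aᵀ w) = inner ℝ (Matrix.toEuclideanLin A v) w := by
  rw [← Matrix.conjTranspose_eq_transpose_of_trivial,
    Matrix.toEuclideanLin_conjTranspose_eq_adjoint, LinearMap.adjoint_inner_right]

/-- Error of the central difference quotient of a function with Lipschitz gradient. -/
lemma abs_centralDiff_sub_inner_le {E : Type*} [NormedAddCommGroup E] [InnerProductSpace ℝ E]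
    [CompleteSpace E] {f : E → ℝ} {L : ℝ} (hL : 0 ≤ L) (hf : Differentiable ℝ f)
    (hlip : ∀ u v, ‖gradient f u - gradient f v‖ ≤ L * ‖u - v‖)
    {ε : ℝ} (hε : 0 < ε) (x q : E) :
    |(f (x + ε • q) - f (x - ε • q)) / (2 * ε) - inner ℝ q (gradient f x)| ≤
      L * ε * ‖q‖ ^ 2 := by
  have hbound : ∀ y ∈ Metric.closedBall x (ε * ‖q‖),
      ‖fderiv ℝ f y - fderiv ℝ f x‖ ≤ L * (ε * ‖q‖) := by
    intro y hy
    have hgrad : ‖fderiv ℝ f y - fderiv ℝ f x‖ = ‖gradient f y - gradient f x‖ := by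
      rw [gradient, gradient, ← map_sub, LinearIsometryEquiv.norm_map]
    rw [hgrad]
    refine (hlip y x).trans (mul_le_mul_of_nonneg_left ?_ hL)
    rwa [mem_closedBall_iff_norm] at hy
  have hmem₁ : x - ε • q ∈ Metric.closedBall x (ε * ‖q‖) := by
    simp [norm_smul, abs_of_pos hε]
  have hmem₂ : x + ε • q ∈ Metric.closedBall x (ε * ‖q‖) := by
    simp [norm_smul, abs_of_pos hε]
  have hmv := (convex_closedBall x (ε * ‖q‖)).norm_image_sub_le_of_norm_fderiv_le'
    (𝕜 := ℝ) (fun y _ => hf y) hbound hmem₁ hmem₂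
  have hsub : x + ε • q - (x - ε • q) = (2 * ε) • q := by module
  have hinner : fderiv ℝ f x q = inner ℝ q (gradient f x) := by
    rw [real_inner_comm, gradient, InnerProductSpace.toDual_symm_apply]
  rw [hsub, map_smul, hinner, norm_smul, smul_eq_mul, Real.norm_eq_abs, Real.norm_eq_abs,
    abs_of_pos (by positivity : 0 < 2 * ε)] at hmv
  have hdiv : (f (x + ε • q) - f (x - ε • q)) / (2 * ε) - inner ℝ q (gradient f x) =
      (f (x + ε • q) - f (x - ε • q) - 2 * ε * inner ℝ q (gradient f x)) / (2 * ε) := by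
    field_simp
  rw [hdiv, abs_div, abs_of_pos (by positivity : 0 < 2 * ε), div_le_iff₀ (by positivity)]
  linarith

lemma norm_le_card_mul_of_forall_abs_le {d : ℕ} (v : EuclideanSpace ℝ (Fin d)) {C : ℝ}
    (h : ∀ i, |v i| ≤ C) : ‖v‖ ≤ d * C := by
  have hsum : v = ∑ i, EuclideanSpace.single i (v i) := by
    ext j
    simp [Finset.sum_apply, Pi.single_apply]
  calc ‖v‖ = ‖∑ i, EuclideanSpace.single i (v i)‖ := by rw [← hsum]
    _ ≤ ∑ i, ‖EuclideanSpace.single i (v i)‖ := norm_sum_le _ _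
    _ ≤ ∑ _i : Fin d, C := Finset.sum_le_sum fun i _ => by simpa using h i
    _ = d * C := by simp

lemma norm_fdGrad_sub_le {n d' : ℕ} {f : EuclideanSpace ℝ (Fin n) → ℝ}
    {L : ℝ} (hL : 0 ≤ L) (hf : Differentiable ℝ f)
    (hlip : ∀ u v, ‖gradient f u - gradient f v‖ ≤ L * ‖u - v‖)
    (Q : Matrix (Fin n) (Fin d') ℝ) {ε : ℝ} (hε : 0 < ε) (x : EuclideanSpace ℝ (Fin n)) :
    ‖fdGrad f Q ε x - Matrix.toEuclideanLin Qᵀ (gradient f x)‖ ≤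
      d' * (L * ε * matOpNorm Q ^ 2) := by
  refine norm_le_card_mul_of_forall_abs_le _ fun i => ?_
  set q := Matrix.toEuclideanLin Q (EuclideanSpace.single i (1 : ℝ)) with hq
  have hcoord : Matrix.toEuclideanLin Qᵀ (gradient f x) i = inner ℝ q (gradient f x) := by
    rw [hq, ← inner_toEuclideanLin_transpose, EuclideanSpace.inner_single_left]
    simp
  have hqnorm : ‖q‖ ≤ matOpNorm Q := by
    simpa using norm_toEuclideanLin_le Q (EuclideanSpace.single i (1 : ℝ))
  have herr := abs_centralDiff_sub_inner_le hL hf hlip hε x q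
  rw [PiLp.sub_apply, hcoord]
  refine le_trans herr ?_
  gcongr

/-- A vector within `‖a‖ / 4` of `a` is well aligned with `a`. -/
lemma norm_mul_norm_le_three_mul_inner {E : Type*} [NormedAddCommGroup E]
    [InnerProductSpace ℝ E] {a h : E} (hclose : ‖h - a‖ ≤ ‖a‖ / 4) :
    ‖a‖ * ‖h‖ ≤ 3 * inner ℝ h a := by
  have hnorm : ‖h‖ ≤ 5 / 4 * ‖a‖ := by
    have := norm_le_norm_add_norm_sub' h a
    linarith
  have hinner : inner ℝ h a = ‖a‖ ^ 2 + inner ℝ (h - a) a := by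
    rw [inner_sub_left, real_inner_self_eq_norm_sq]
    ring
  have hcs := neg_le_of_abs_le (abs_real_inner_le_norm (h - a) a)
  nlinarith [norm_nonneg a]

/-- Let `f` be continuously differentiable with `L`-Lipschitz gradient and `ε > 0`. If
`‖Qᵀ∇f(x)‖ ≥ 4 d' ‖Q‖_op² L ε` (so `Q∇_{Q,ε}f(x) ≠ 0`) and `P` has a column equal to
`Q∇_{Q,ε}f(x)/‖Q∇_{Q,ε}f(x)‖`, then `‖Pᵀ∇f(x)‖ ≥ (1/3) ‖Qᵀ∇f(x)‖ / ‖Q‖_op`. -/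
theorem stmt12 {n m d' : ℕ} (f : EuclideanSpace ℝ (Fin n) → ℝ)
    (L : ℝ) (hL : 0 < L) (hf : ContDiff ℝ 1 f)
    (hlip : ∀ u v : EuclideanSpace ℝ (Fin n),
      ‖gradient f u - gradient f v‖ ≤ L * ‖u - v‖)
    (Q : Matrix (Fin n) (Fin d') ℝ) (ε : ℝ) (hε : 0 < ε)
    (x : EuclideanSpace ℝ (Fin n))
    (hbig : 4 * d' * matOpNorm Q ^ 2 * L * ε ≤
      ‖Matrix.toEuclideanLin Qᵀ (gradient f x)‖)
    (hne : Matrix.toEuclideanLin Q (fdGrad f Q ε x) ≠ 0)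
    (P : Matrix (Fin n) (Fin m) ℝ)
    (hcol : ∃ j : Fin m,
      Matrix.toEuclideanLin P (EuclideanSpace.single j (1 : ℝ)) =
        ‖Matrix.toEuclideanLin Q (fdGrad f Q ε x)‖⁻¹ •
          Matrix.toEuclideanLin Q (fdGrad f Q ε x)) :
    (1 / 3) * ‖Matrix.toEuclideanLin Qᵀ (gradient f x)‖ / matOpNorm Q ≤
      ‖Matrix.toEuclideanLin Pᵀ (gradient f x)‖ := by
  set g := gradient f x
  set h := fdGrad f Q ε x
  set a := Matrix.toEuclideanLin Qᵀ g
  obtain ⟨j, hj⟩ := hcol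
  have herr : ‖h - a‖ ≤ ‖a‖ / 4 := by
    have := norm_fdGrad_sub_le hL.le (hf.differentiable one_ne_zero) hlip Q hε x
    linarith
  have halign := norm_mul_norm_le_three_mul_inner herr
  have hQh : ‖Matrix.toEuclideanLin Q h‖ ≤ matOpNorm Q * ‖h‖ := norm_toEuclideanLin_le Q h
  have hQh_pos : 0 < ‖Matrix.toEuclideanLin Q h‖ := norm_pos_iff.mpr hne
  have hQ : 0 < matOpNorm Q := pos_of_mul_pos_left (hQh_pos.trans_le hQh) (norm_nonneg h)
  have hcol_inner : inner ℝ h a ≤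
      ‖Matrix.toEuclideanLin Q h‖ * ‖Matrix.toEuclideanLin Pᵀ g‖ := by
    have hcs := real_inner_le_norm (EuclideanSpace.single j (1 : ℝ))
      (Matrix.toEuclideanLin Pᵀ g)
    rw [inner_toEuclideanLin_transpose, hj, real_inner_smul_left,
      ← inner_toEuclideanLin_transpose, PiLp.norm_single, norm_one, one_mul] at hcs
    exact (inv_mul_le_iff₀ hQh_pos).mp hcs
  rw [div_le_iff₀ hQ]
  have hh : 0 < ‖h‖ := pos_of_mul_pos_right (hQh_pos.trans_le hQh) hQ.le
  have hscaled := mul_le_mul_of_nonneg_right hQh (norm_nonneg (Matrix.toEuclideanLin Pᵀ g))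
  refine le_of_mul_le_mul_right ?_ hh
  linarith
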